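/- arXiv:1612.02988 — 2 statements merged into one kernel-verified Lean document; each statement's English description precedes it below -/
import Mathlib

section
/- Every connected Cayley graph of even order at least 4 on a finite group is 1-extendable. -/
open SimpleGraph

/-- A simple graph is vertex-transitive if any vertex can be mapped to any other
by a graph automorphism. -/
def IsVertexTransitive {V : Type*} (G : SimpleGraph V) : Prop :=
  ∀ x y : V, ∃ φ : G ≃g G, φ x = y

/-- A graph `G` with at least `2*n+2` vertices is `n`-extendable if it has a matching
of size `n` and every matching of size `n` extends to a perfect matching. -/
def IsNExtendable {V : Type*} [Fintype V] (G : SimpleGraph V) (n : ℕ) : Prop :=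
  2 * n + 2 ≤ Fintype.card V ∧
    (∃ M : G.Subgraph, M.IsMatching ∧ M.edgeSet.ncard = n) ∧
    ∀ M : G.Subgraph, M.IsMatching → M.edgeSet.ncard = n →
      ∃ P : G.Subgraph, P.IsPerfectMatching ∧ M.edgeSet ⊆ P.edgeSet

/-- The Cayley graph of a group `Γ` with respect to an inverse-closed connecting set `S`:
distinct `x, y` are adjacent iff `x * y⁻¹ ∈ S`. -/
def cayleyGraph (Γ : Type*) [Group Γ] (S : Set Γ) (hS : ∀ s ∈ S, s⁻¹ ∈ S) :
    SimpleGraph Γ where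
  Adj x y := x ≠ y ∧ x * y⁻¹ ∈ S
  symm := by
    constructor
    rintro x y ⟨hxy, hs⟩
    exact ⟨hxy.symm, by simpa [mul_inv_rev] using hS _ hs⟩
  loopless := ⟨fun x h => h.1 rfl⟩

open Classical in
noncomputable def cutE {V : Type*} [Fintype V] (G : SimpleGraph V) (A : Finset V) : Finset (V × V) :=
  Finset.univ.filter fun p => p.1 ∈ A ∧ p.2 ∉ A ∧ G.Adj p.1 p.2

lemma mem_cutE {V : Type*} [Fintype V] (G : SimpleGraph V) (A : Finset V) (x y : V) :
    (x, y) ∈ cutE G A ↔ x ∈ A ∧ y ∉ A ∧ G.Adj x y := by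
  simp [cutE]

open Classical in
lemma cutE_submod {V : Type*} [Fintype V] (G : SimpleGraph V) (A B : Finset V) :
    (cutE G (A ∩ B)).card + (cutE G (A ∪ B)).card ≤ (cutE G A).card + (cutE G B).card := by
  simp only [cutE, Finset.card_filter, ← Finset.sum_add_distrib]
  apply Finset.sum_le_sum
  rintro ⟨x, y⟩ -
  by_cases h1 : x ∈ A <;> by_cases h2 : x ∈ B <;> by_cases h3 : y ∈ A <;> by_cases h4 : y ∈ B <;>
    by_cases h5 : G.Adj x y <;> simp [h1, h2, h3, h4, h5]

open Classical in
lemma cutE_compl {V : Type*} [Fintype V] (G : SimpleGraph V) (A : Finset V) :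
    (cutE G Aᶜ).card = (cutE G A).card := by
  apply Finset.card_bij (fun p _ => (p.2, p.1))
  · rintro ⟨x, y⟩ h
    simp only [cutE, Finset.mem_filter, Finset.mem_univ, Finset.mem_compl, true_and, not_not] at h ⊢
    exact ⟨h.2.1, h.1, h.2.2.symm⟩
  · rintro ⟨x, y⟩ _ ⟨z, w⟩ _ h
    simp_all
  · rintro ⟨x, y⟩ h
    refine ⟨(y, x), ?_, rfl⟩
    simp only [cutE, Finset.mem_filter, Finset.mem_univ, Finset.mem_compl, true_and, not_not] at h ⊢
    exact ⟨h.2.1, h.1, h.2.2.symm⟩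

open Classical in
/-- Atoms containing a common point coincide. -/
lemma atom_eq {V : Type*} [Fintype V] (G : SimpleGraph V) (lam m : ℕ)
    (hl : ∀ A : Finset V, A.Nonempty → A ≠ Finset.univ → lam ≤ (cutE G A).card)
    (hm : ∀ A : Finset V, A.Nonempty → A ≠ Finset.univ → (cutE G A).card = lam → m ≤ A.card)
    (A B : Finset V) (hA : (cutE G A).card = lam) (hB : (cutE G B).card = lam)
    (hAu : A ≠ Finset.univ)
    (hAm : A.card = m) (hBm : B.card = m) (hAB : (A ∩ B).Nonempty) : A = B := by
  have hAne : A.Nonempty := hAB.mono Finset.inter_subset_left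
  have hc : m ≤ Aᶜ.card := by
    apply hm
    · rw [Finset.nonempty_iff_ne_empty]; simpa using hAu
    · simpa using hAne.ne_empty
    · rw [cutE_compl, hA]
  have hcc := Finset.card_compl_add_card A
  have h0 : 0 < (A ∩ B).card := Finset.card_pos.mpr hAB
  have hui := Finset.card_union_add_card_inter A B
  have hU : A ∪ B ≠ Finset.univ := by
    intro h
    rw [h, Finset.card_univ] at hui
    omega
  have hI : A ∩ B ≠ Finset.univ := by
    intro h
    apply hAu
    apply Finset.eq_univ_of_forall
    intro x
    have : x ∈ A ∩ B := by rw [h]; simp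
    exact (Finset.mem_inter.mp this).1
  have h1 := hl _ hAB hI
  have h2 := hl _ (hAne.mono (Finset.subset_union_left (s₂ := B))) hU
  have h3 := cutE_submod G A B
  have h4 := hm _ hAB hI (by omega)
  have e1 : A ∩ B = A := Finset.eq_of_subset_of_card_le Finset.inter_subset_left (by omega)
  have e2 : A ∩ B = B := Finset.eq_of_subset_of_card_le Finset.inter_subset_right (by omega)
  rw [← e1, e2]

lemma cayleyGraph_adj {Γ : Type*} [Group Γ] (S : Set Γ)
    (hS : ∀ s ∈ S, s⁻¹ ∈ S) (x y : Γ) :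
    (cayleyGraph Γ S hS).Adj x y ↔ x ≠ y ∧ x * y⁻¹ ∈ S := Iff.rfl

open Classical in
lemma cutE_translate {Γ : Type*} [Group Γ] [Fintype Γ] (S : Set Γ)
    (hS : ∀ s ∈ S, s⁻¹ ∈ S) (A : Finset Γ) (g : Γ) :
    (cutE (cayleyGraph Γ S hS) (A.map (Equiv.mulRight g).toEmbedding)).card =
      (cutE (cayleyGraph Γ S hS) A).card := by
  symm
  apply Finset.card_bij (fun p _ => (p.1 * g, p.2 * g))
  · rintro ⟨x, y⟩ h
    rw [mem_cutE, cayleyGraph_adj] at h ⊢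
    simpa using h
  · rintro ⟨x, y⟩ _ ⟨z, w⟩ _ h
    simp_all
  · rintro ⟨x, y⟩ h
    refine ⟨(x * g⁻¹, y * g⁻¹), ?_, by simp⟩
    rw [mem_cutE, cayleyGraph_adj] at h ⊢
    simp only [Finset.mem_map_equiv, Equiv.mulRight_symm, Equiv.coe_mulRight] at h
    simpa using h

open Classical in
lemma subgroup_cut {Γ : Type*} [Group Γ] [Fintype Γ] (S : Set Γ)
    (hS : ∀ s ∈ S, s⁻¹ ∈ S) (hid : (1 : Γ) ∉ S) (hgen : Subgroup.closure S = ⊤)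
    (H : Subgroup Γ) (hH : H ≠ ⊤) :
    S.toFinset.card ≤ (cutE (cayleyGraph Γ S hS) (Finset.univ.filter (· ∈ H))).card := by
  have hout : ∃ s ∈ S, s ∉ H := by
    by_contra! h
    apply hH
    rw [eq_top_iff, ← hgen]
    exact (Subgroup.closure_le H).mpr h
  obtain ⟨s, hs, hsH⟩ := hout
  set HF : Finset Γ := Finset.univ.filter (· ∈ H) with hHF
  have key : (cutE (cayleyGraph Γ S hS) HF).card =
      (HF ×ˢ (S.toFinset.filter (· ∉ H))).card := by
    apply Finset.card_bij (fun p _ => (p.1, p.1 * p.2⁻¹))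
    · rintro ⟨x, y⟩ h
      simp only [cutE, hHF, cayleyGraph, Finset.mem_filter, Finset.mem_univ, true_and,
        Finset.mem_product, Set.mem_toFinset] at h ⊢
      refine ⟨h.1, h.2.2.2, fun h' => h.2.1 ?_⟩
      simpa using (H.mul_mem_cancel_left h.1).mp h'
    · rintro ⟨x, y⟩ _ ⟨z, w⟩ _ h
      simp only [Prod.mk.injEq] at h
      obtain ⟨rfl, h⟩ := h
      simpa using h
    · rintro ⟨x, t⟩ h
      simp only [cutE, hHF, cayleyGraph, Finset.mem_filter, Finset.mem_univ, true_and,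
        Finset.mem_product, Set.mem_toFinset] at h ⊢
      have hn : t⁻¹ * x ∉ H := fun h' => h.2.2 (by
        simpa using (H.mul_mem_cancel_right h.1).mp h')
      refine ⟨(x, t⁻¹ * x), ⟨h.1, hn, ?_, by simpa using h.2.1⟩, by simp⟩
      intro he
      apply hn
      change x = t⁻¹ * x at he
      rw [← he]
      exact h.1
  rw [key, Finset.card_product]
  have hsplit := Finset.card_filter_add_card_filter_not (s := S.toFinset) (· ∈ H)
  have h1 : 0 < (S.toFinset.filter (· ∉ H)).card :=
    Finset.card_pos.mpr ⟨s, by simp [hs, hsH]⟩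
  have h2 : (S.toFinset.filter (· ∈ H)).card < HF.card := by
    apply Finset.card_lt_card
    rw [Finset.ssubset_iff_of_subset (by intro x; simp [hHF])]
    exact ⟨1, by simp [hHF, H.one_mem], by simp [hid]⟩
  generalize (S.toFinset.filter (· ∈ H)).card = k at *
  generalize (S.toFinset.filter (· ∉ H)).card = j at *
  generalize HF.card = m at *
  nlinarith

open Classical in
lemma cayley_cut {Γ : Type*} [Group Γ] [Fintype Γ] (S : Set Γ)
    (hS : ∀ s ∈ S, s⁻¹ ∈ S) (hid : (1 : Γ) ∉ S) (hgen : Subgroup.closure S = ⊤)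
    (A₀ : Finset Γ) (h0 : A₀.Nonempty) (h1 : A₀ ≠ Finset.univ) :
    S.toFinset.card ≤ (cutE (cayleyGraph Γ S hS) A₀).card := by
  set G := cayleyGraph Γ S hS
  obtain ⟨L, hL, hLmin⟩ := Finset.exists_min_image
    (Finset.univ.filter fun A : Finset Γ => A.Nonempty ∧ A ≠ Finset.univ)
    (fun A => (cutE G A).card) ⟨A₀, by simp [h0, h1]⟩
  simp only [Finset.mem_filter, Finset.mem_univ, true_and] at hL hLmin
  obtain ⟨A, hA, hAmin⟩ := Finset.exists_min_image
    (Finset.univ.filter fun A : Finset Γ => A.Nonempty ∧ A ≠ Finset.univ ∧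
      (cutE G A).card = (cutE G L).card)
    (fun A => A.card) ⟨L, by simp [hL.1, hL.2]⟩
  simp only [Finset.mem_filter, Finset.mem_univ, true_and] at hA hAmin
  obtain ⟨hAne, hAu, hAc⟩ := hA
  refine le_trans ?_ (hLmin A₀ ⟨h0, h1⟩)
  have htr : ∀ g h : Γ, (A.map (Equiv.mulRight g).toEmbedding ∩
      A.map (Equiv.mulRight h).toEmbedding).Nonempty →
      A.map (Equiv.mulRight g).toEmbedding = A.map (Equiv.mulRight h).toEmbedding := by
    intro g h hne
    refine atom_eq G (cutE G L).card A.card (fun B b1 b2 => hLmin B ⟨b1, b2⟩)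
      (fun B b1 b2 b3 => hAmin B ⟨b1, b2, b3⟩) _ _ ?_ ?_ ?_ (by simp) (by simp) hne
    · rw [cutE_translate, hAc]
    · rw [cutE_translate, hAc]
    · intro h'
      apply hAu
      rw [← Finset.card_eq_iff_eq_univ] at h' ⊢
      simpa using h'
  obtain ⟨a, ha⟩ := hAne
  have hmem : ∀ x g : Γ, x ∈ A.map (Equiv.mulRight g).toEmbedding ↔ x * g⁻¹ ∈ A := by
    intro x g
    simp [Finset.mem_map_equiv]
  have hstep : ∀ x y z : Γ, x * a ∈ A → y * a ∈ A → (z * x * a ∈ A ↔ z * y * a ∈ A) := by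
    intro x y z hx hy
    have := htr (x * a)⁻¹ (y * a)⁻¹ ⟨1, by
      rw [Finset.mem_inter, hmem, hmem]
      simp [hx, hy]⟩
    have h2 : z ∈ A.map (Equiv.mulRight (x * a)⁻¹).toEmbedding ↔
        z ∈ A.map (Equiv.mulRight (y * a)⁻¹).toEmbedding := by rw [this]
    rw [hmem, hmem, inv_inv, inv_inv] at h2
    simpa only [mul_assoc] using h2
  let H : Subgroup Γ :=
    { carrier := {x | x * a ∈ A}
      one_mem' := by simpa using ha
      mul_mem' := by
        intro x y hx hy
        exact (hstep 1 y x (by simpa using ha) hy).mp (by simpa using hx)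
      inv_mem' := by
        intro x hx
        have := (hstep x 1 x⁻¹ hx (by simpa using ha)).mp (by simpa using ha)
        simpa using this }
  have hHm : ∀ x, x ∈ H ↔ x * a ∈ A := fun x => Iff.rfl
  have hHA : Finset.univ.filter (· ∈ H) = A.map (Equiv.mulRight a⁻¹).toEmbedding := by
    ext x
    simp only [Finset.mem_filter, Finset.mem_univ, true_and, hmem, inv_inv, hHm]
  have hHt : H ≠ ⊤ := by
    intro h
    apply hAu
    apply Finset.eq_univ_of_forall
    intro x
    have : x * a⁻¹ ∈ H := by rw [h]; trivial
    simpa [hHm] using this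
  have := subgroup_cut S hS hid hgen H hHt
  rw [hHA, cutE_translate] at this
  exact hAc ▸ this

open Classical in
lemma count_contra {V : Type*} [Fintype V] (G : SimpleGraph V) (d : ℕ)
    (hreg : ∀ y, (Finset.univ.filter fun x => G.Adj x y).card = d)
    (hcut : ∀ A : Finset V, A.Nonempty → A ≠ Finset.univ → d ≤ (cutE G A).card)
    (u v : V) (huv : G.Adj u v) (T : Finset V) (hu : u ∈ T) (hv : v ∈ T)
    {ι : Type*} [Fintype ι] (C : ι → Finset V) (hne : ∀ i, (C i).Nonempty)
    (hdis : ∀ i j, i ≠ j → Disjoint (C i) (C j)) (hT : ∀ i, ∀ x ∈ C i, x ∉ T)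
    (hcl : ∀ i, ∀ x ∈ C i, ∀ y, G.Adj x y → y ∈ C i ∨ y ∈ T)
    (hcard : T.card ≤ Fintype.card ι) : False := by
  have h1 : Fintype.card ι * d ≤ ∑ i, (cutE G (C i)).card := by
    rw [← smul_eq_mul, ← Finset.card_univ]
    apply Finset.card_nsmul_le_sum
    intro i _
    refine hcut _ (hne i) fun h => hT i u (by rw [h]; simp) hu
  rw [← Finset.card_biUnion] at h1
  · let R : Finset (V × V) := Finset.univ.filter fun p => p.2 ∈ T ∧ G.Adj p.1 p.2
    have hR : R.card = T.card * d := by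
      rw [Finset.card_eq_sum_card_fiberwise (f := Prod.snd) (t := T)]
      · rw [← smul_eq_mul, ← Finset.sum_const]
        apply Finset.sum_congr rfl
        intro y hy
        rw [← hreg y]
        apply Finset.card_bij (fun p _ => p.1)
        · rintro ⟨a, b⟩ h
          simp only [R, Finset.mem_filter, Finset.mem_univ, true_and] at h ⊢
          exact h.2 ▸ h.1.2
        · rintro ⟨a, b⟩ h ⟨a', b'⟩ h' e
          simp only [Finset.mem_filter] at h h' e
          rw [e, h.2, h'.2]
        · intro a h
          refine ⟨(a, y), ?_, rfl⟩
          simp only [R, Finset.mem_filter, Finset.mem_univ, true_and] at h ⊢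
          exact ⟨⟨hy, h⟩, trivial⟩
      · intro p hp
        simp only [R, Finset.coe_filter, Finset.mem_univ, true_and, Set.mem_ofPred_eq] at hp
        exact hp.1
    have hlt : (Finset.univ.biUnion fun i => cutE G (C i)).card < R.card := by
      apply Finset.card_lt_card
      rw [Finset.ssubset_iff_of_subset]
      · refine ⟨(u, v), by simp [R, hv, huv], ?_⟩
        simp only [Finset.mem_biUnion, mem_cutE]
        rintro ⟨i, -, h, -⟩
        exact hT i u h hu
      · rintro ⟨x, y⟩ h
        simp only [Finset.mem_biUnion, mem_cutE] at h
        obtain ⟨i, -, h1, h2, h3⟩ := h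
        simp only [R, Finset.mem_filter, Finset.mem_univ, true_and]
        exact ⟨(hcl i x h1 y h3).resolve_left h2, h3⟩
    have := Nat.mul_le_mul_right d hcard
    omega
  · intro i _ j _ hij
    rw [Function.onFun, Finset.disjoint_left]
    rintro ⟨x, y⟩ h h'
    rw [mem_cutE] at h h'
    exact Finset.disjoint_left.mp (hdis i j hij) h.1 h'.1

open Classical in
lemma exists_pm {V : Type*} [Fintype V] (G : SimpleGraph V) (d : ℕ)
    (hreg : ∀ y, (Finset.univ.filter fun x => G.Adj x y).card = d)
    (hcut : ∀ A : Finset V, A.Nonempty → A ≠ Finset.univ → d ≤ (cutE G A).card)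
    (heven : Even (Fintype.card V))
    (u v : V) (huv : G.Adj u v) :
    ∃ P : G.Subgraph, P.IsPerfectMatching ∧ P.Adj u v := by
  let W : Set V := {x | x ≠ u ∧ x ≠ v}
  by_cases hM : ∃ M : (G.induce W).Subgraph, M.IsPerfectMatching
  · obtain ⟨M, hM⟩ := hM
    refine ⟨M.map (Embedding.induce W).toHom ⊔ G.subgraphOfAdj huv, ⟨?_, ?_⟩, ?_⟩
    · apply Subgraph.IsMatching.sup
      · exact hM.1.map _ (Embedding.induce (G := G) W).injective
      · exact Subgraph.IsMatching.subgraphOfAdj huv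
      · rw [Set.disjoint_left]
        intro x hx hx'
        have h1 := Subgraph.support_subset_verts _ hx
        have h2 := Subgraph.support_subset_verts _ hx'
        obtain ⟨⟨y, hy⟩, -, rfl⟩ := h1
        rcases h2 with h2 | h2
        · exact hy.1 h2
        · exact hy.2 h2
    · intro x
      by_cases hx : x ∈ W
      · left
        exact ⟨⟨x, hx⟩, hM.2 _, rfl⟩
      · right
        have : x = u ∨ x = v := by
          by_contra! h
          exact hx h
        simpa using this
    · right
      simp
  · exfalso
    rw [tutte] at hM
    push Not at hM
    obtain ⟨T, hT⟩ := hM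
    unfold IsTutteViolator at hT
    set K := ((⊤ : (G.induce W).Subgraph).deleteVerts T).coe with hK
    have hpar := odd_ncard_oddComponents K
    have hcW : Nat.card W + 2 = Fintype.card V := by
      have e : Wᶜ = {u, v} := by
        ext x
        simp only [W, Set.mem_compl_iff, Set.mem_ofPred_eq, Set.mem_insert_iff,
          Set.mem_singleton_iff]
        tauto
      have := Set.ncard_add_ncard_compl W
      rw [e, Set.ncard_pair huv.ne, Nat.card_eq_fintype_card] at this
      exact this
    have hcK : Nat.card ((⊤ : (G.induce W).Subgraph).deleteVerts T).verts + T.ncard = Nat.card W := by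
      have e : ((⊤ : (G.induce W).Subgraph).deleteVerts T).verts = Tᶜ := by
        ext x
        simp
      rw [e, add_comm]
      exact Set.ncard_add_ncard_compl T
    have hcount : T.ncard + 2 ≤ K.oddComponents.ncard := by
      rw [← Nat.not_even_iff_odd, ← Nat.not_even_iff_odd, Nat.even_iff, Nat.even_iff] at hpar
      rw [Nat.even_iff] at heven
      omega
    let T' : Finset V := {u, v} ∪ (T.toFinset.image Subtype.val)
    have hT'c : T'.card ≤ T.ncard + 2 := by
      refine (Finset.card_union_le _ _).trans ?_
      have h1 := Finset.card_le_two (a := u) (b := v)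
      have h2 : (T.toFinset.image Subtype.val).card ≤ T.toFinset.card := Finset.card_image_le
      rw [Set.ncard_eq_toFinset_card' T]
      omega
    let f : ((⊤ : (G.induce W).Subgraph).deleteVerts T).verts → V := fun x => x.1.1
    have hf : Function.Injective f := fun x y h => Subtype.ext (Subtype.ext h)
    let C : K.oddComponents → Finset V := fun c => (f '' c.1.supp).toFinset
    have hmC : ∀ c x, x ∈ C c ↔ ∃ z ∈ c.1.supp, f z = x := by
      intro c x
      simp only [C, Set.mem_toFinset, Set.mem_image]
    have hmT : ∀ x, x ∈ T' ↔ x = u ∨ x = v ∨ ∃ h : x ∈ W, (⟨x, h⟩ : W) ∈ T := by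
      intro x
      simp [T']
    refine count_contra G d hreg hcut u v huv T' (by simp [T']) (by simp [T']) C ?_ ?_ ?_ ?_ ?_
    · intro c
      obtain ⟨z, hz⟩ := c.1.nonempty_supp
      exact ⟨f z, (hmC _ _).mpr ⟨z, hz, rfl⟩⟩
    · intro c c' hcc
      rw [Finset.disjoint_left]
      intro x hx hx'
      obtain ⟨z, hz, rfl⟩ := (hmC _ _).mp hx
      obtain ⟨z', hz', e⟩ := (hmC _ _).mp hx'
      obtain rfl := hf e
      rw [ConnectedComponent.mem_supp_iff] at hz hz'
      exact hcc (Subtype.ext (hz.symm.trans hz'))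
    · intro c x hx hxT
      obtain ⟨z, hz, rfl⟩ := (hmC _ _).mp hx
      rcases (hmT _).mp hxT with h | h | ⟨h, h'⟩
      · exact z.1.2.1 h
      · exact z.1.2.2 h
      · exact z.2.2 h'
    · intro c x hx y hxy
      obtain ⟨z, hz, rfl⟩ := (hmC _ _).mp hx
      by_cases hy : y ∈ T'
      · exact Or.inr hy
      left
      rw [hmT] at hy
      push Not at hy
      have hyW : y ∈ W := ⟨hy.1, hy.2.1⟩
      have hyK : (⟨y, hyW⟩ : W) ∈ ((⊤ : (G.induce W).Subgraph).deleteVerts T).verts :=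
        ⟨trivial, hy.2.2 hyW⟩
      refine (hmC _ _).mpr ⟨⟨⟨y, hyW⟩, hyK⟩, ?_, rfl⟩
      refine c.1.mem_supp_of_adj_mem_supp hz ?_
      rw [hK, Subgraph.coe_adj, Subgraph.deleteVerts_adj]
      exact ⟨trivial, z.2.2, trivial, hyK.2, hxy⟩
    · rw [← Nat.card_eq_fintype_card, Nat.card_coe_set_eq]
      omega

/-- Every connected Cayley graph of even order at least 4 on a finite group is
1-extendable. -/
theorem cayley_one_extendable (Γ : Type*) [Group Γ] [Fintype Γ] (S : Set Γ)
    (hS : ∀ s ∈ S, s⁻¹ ∈ S) (hid : (1 : Γ) ∉ S) (hgen : Subgroup.closure S = ⊤)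
    (hconn : (cayleyGraph Γ S hS).Connected)
    (heven : Even (Fintype.card Γ)) (hcard : 4 ≤ Fintype.card Γ) :
    IsNExtendable (cayleyGraph Γ S hS) 1 := by
  classical
  refine ⟨by omega, ?_, ?_⟩
  · have hSne : S.Nonempty := by
      rw [Set.nonempty_iff_ne_empty]
      rintro rfl
      rw [Subgroup.closure_empty] at hgen
      have h1 := congrArg (fun H : Subgroup Γ => Nat.card H) hgen
      simp at h1
      omega
    obtain ⟨s, hs⟩ := hSne
    have hadj : (cayleyGraph Γ S hS).Adj s 1 :=
      ⟨fun h => hid (h ▸ hs), by simpa using hs⟩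
    exact ⟨(cayleyGraph Γ S hS).subgraphOfAdj hadj, Subgraph.IsMatching.subgraphOfAdj hadj,
      by simp⟩
  · intro M hM hM1
    obtain ⟨e, he⟩ := Set.ncard_eq_one.mp hM1
    rw [he]
    induction e using Sym2.ind with
    | _ u v =>
      have huv : M.Adj u v := by
        rw [← Subgraph.mem_edgeSet, he]
        rfl
      obtain ⟨P, hP, hPuv⟩ := exists_pm (cayleyGraph Γ S hS) S.toFinset.card
        (by
          intro y
          apply Finset.card_bij (fun x _ => x * y⁻¹)
          · intro x h
            simp only [Finset.mem_filter, Finset.mem_univ, true_and, cayleyGraph_adj] at h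
            simpa using h.2
          · intro a _ b _ h
            simpa using h
          · intro t ht
            rw [Set.mem_toFinset] at ht
            refine ⟨t * y, ?_, by simp⟩
            simp only [Finset.mem_filter, Finset.mem_univ, true_and, cayleyGraph_adj]
            refine ⟨fun h => hid ?_, by simpa using ht⟩
            have : t = 1 := by simpa using h
            exact this ▸ ht)
        (cayley_cut S hS hid hgen) heven u v huv.adj_sub
      exact ⟨P, hP, by simpa using hPuv⟩
end

section
/- Let G = G(Γ,S) be a connected bipartite Cayley graph on a finite group Γ with at least 6 elements. Then G is 2-extendable if and only if G is not isomorphic to a cycle graph. -/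
open SimpleGraph

open Pointwise

section key
set_option linter.unusedSectionVars false
variable {Γ : Type*} [Group Γ] [Fintype Γ] [DecidableEq Γ]

theorem k_pos (F : Finset Γ) (hF : ∀ s ∈ F, s⁻¹ ∈ F) (hgen : Subgroup.closure (F : Set Γ) = ⊤)
    (hne : F.Nonempty) (X : Finset Γ) (hX : X.Nonempty) (hlt : 2 * X.card < Fintype.card Γ) :
    X.card + 1 ≤ (F * X).card := by
  by_contra hcon
  obtain ⟨s0, hs0⟩ := hne
  have key : ∀ s ∈ F, s • X = F * X := by
    intro s hs
    apply Finset.eq_of_subset_of_card_le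
    · exact Finset.smul_finset_subset_mul hs
    · rw [Finset.card_smul_finset]; omega
  have hcl : ∀ g : Γ, ∀ x ∈ X ∪ F * X, g * x ∈ X ∪ F * X := by
    intro g
    have hg : g ∈ Subgroup.closure (F : Set Γ) := by rw [hgen]; trivial
    have hs : ∀ s ∈ F, ∀ x ∈ X ∪ F * X, s * x ∈ X ∪ F * X := by
      intro s hs x hx
      rw [Finset.mem_union] at hx ⊢
      rcases hx with hx | hx
      · exact Or.inr (Finset.mul_mem_mul hs hx)
      · left
        rw [← key _ (hF s hs)] at hx
        obtain ⟨y, hy, rfl⟩ := Finset.mem_smul_finset.1 hx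
        simpa using hy
    induction hg using Subgroup.closure_induction'' with
    | mem s h => exact hs s h
    | inv_mem s h => exact hs _ (hF s h)
    | one => simp
    | mul a b _ _ ha hb => intro x hx; rw [mul_assoc]; exact ha _ (hb _ hx)
  obtain ⟨x0, hx0⟩ := hX
  have : X ∪ F * X = Finset.univ := by
    ext y
    simp only [Finset.mem_univ, iff_true]
    have := hcl (y * x0⁻¹) x0 (Finset.mem_union_left _ hx0)
    simpa using this
  have h2 := Finset.card_union_le X (F * X)
  rw [this, Finset.card_univ] at h2
  omega

def IsFrag (F : Finset Γ) (c : Γ → Bool) (X : Finset Γ) : Prop :=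
  X.Nonempty ∧ (∃ b, ∀ x ∈ X, c x = b) ∧ 2 * X.card + 4 ≤ Fintype.card Γ ∧
    (F * X).card ≤ X.card + 1

theorem class_card (c : Γ → Bool) (hc : ∀ x y, c (x * y) = xor (c x) (c y)) (s : Γ)
    (hs : c s = true) (b : Bool) :
    2 * (Finset.univ.filter (fun x => c x = b)).card = Fintype.card Γ := by
  have h1 : (Finset.univ.filter (fun x => c x = b)).card =
      (Finset.univ.filter (fun x => ¬ c x = b)).card := by
    apply Finset.card_bij (fun x _ => s * x)
    · intro a ha; simp [hc, hs] at ha ⊢; simp [ha]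
    · intro a _ b _ h; simpa using h
    · intro y hy
      refine ⟨s⁻¹ * y, ?_, by simp⟩
      have : c y = xor (c s) (c (s⁻¹ * y)) := by rw [← hc]; simp
      simp at hy ⊢
      rw [hs] at this
      cases h : c (s⁻¹ * y) <;> cases b <;> simp_all
  have h2 := Finset.card_filter_add_card_filter_not (s := (Finset.univ : Finset Γ)) (fun x => c x = b)
  rw [Finset.card_univ] at h2
  omega

theorem no_frag (F : Finset Γ) (hF : ∀ s ∈ F, s⁻¹ ∈ F)
    (hgen : Subgroup.closure (F : Set Γ) = ⊤) (h3 : 3 ≤ F.card)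
    (c : Γ → Bool) (hc : ∀ x y, c (x * y) = xor (c x) (c y)) (hcF : ∀ s ∈ F, c s = true)
    (X : Finset Γ) : ¬ IsFrag F c X := by
  have hne : F.Nonempty := Finset.card_pos.1 (by omega)
  induction hn : X.card using Nat.strong_induction_on generalizing X with
  | _ n ih =>
  rintro ⟨hX, ⟨b, hb⟩, hbig, hN⟩
  have hpos := k_pos F hF hgen hne X hX (by omega)
  obtain ⟨s0, hs0⟩ := hne
  have hX2 : 2 ≤ X.card := by
    by_contra h
    have h1 : X.card = 1 := by have := hX.card_pos; omega
    obtain ⟨x, rfl⟩ := Finset.card_eq_one.1 h1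
    rw [Finset.mul_singleton, Finset.card_smul_finset] at hN
    simp at hN; omega
  -- dual
  have hcX : ∀ y ∈ F * X, c y = !b := by
    intro y hy
    obtain ⟨s, hs, x, hx, rfl⟩ := Finset.mem_mul.1 hy
    simp [hc, hcF s hs, hb x hx]
  have hsize : 4 * X.card + 2 ≤ Fintype.card Γ := by
    set Y := (Finset.univ.filter (fun x => c x = !b)) \ (F * X) with hY
    have hYc : Y.card = (Finset.univ.filter (fun x => c x = !b)).card - (F * X).card := by
      apply Finset.card_sdiff_of_subset
      intro y hy; simp [hcX y hy]
    have hc1 := class_card c hc s0 (hcF _ hs0) (!b)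
    have hc2 := class_card c hc s0 (hcF _ hs0) b
    have hNY : (F * Y) ⊆ (Finset.univ.filter (fun x => c x = b)) \ X := by
      intro z hz
      obtain ⟨s, hs, y, hy, rfl⟩ := Finset.mem_mul.1 hz
      simp only [hY, Finset.mem_sdiff, Finset.mem_filter, Finset.mem_univ, true_and] at hy ⊢
      refine ⟨by simp [hc, hcF s hs, hy.1], fun h => hy.2 ?_⟩
      have := Finset.mul_mem_mul (hF s hs) h
      simpa using this
    have hNYc := Finset.card_le_card hNY
    rw [Finset.card_sdiff_of_subset (by intro x hx; simp [hb x hx])] at hNYc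
    by_contra hlt
    refine ih Y.card (by omega) Y rfl ⟨Finset.card_pos.1 (by omega), ⟨!b, ?_⟩, by omega, by omega⟩
    intro y hy; simp [hY] at hy; exact hy.1
  -- block property
  have block : ∀ g x, x ∈ X → x * g ∈ X → ∀ z ∈ X, z * g ∈ X := by
    intro g x hx hxg
    set X' := X.image (· * g) with hX'
    have hX'c : X'.card = X.card := Finset.card_image_of_injective _ (mul_left_injective g)
    have hNX' : (F * X').card = (F * X).card := by
      have : F * X' = (F * X).image (· * g) := by
        have im : ∀ Z : Finset Γ, Z.image (· * g) = Z * {g} := by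
          intro Z; ext z
          simp only [Finset.mem_mul, Finset.mem_image, Finset.mem_singleton, exists_eq_left]
        rw [hX', im, im, mul_assoc]
      rw [this]; exact Finset.card_image_of_injective _ (mul_left_injective g)
    have hmem : x * g ∈ X ∩ X' := Finset.mem_inter.2 ⟨hxg, Finset.mem_image_of_mem _ hx⟩
    have hip : 0 < (X ∩ X').card := Finset.card_pos.2 ⟨_, hmem⟩
    have hcu := Finset.card_union_add_card_inter X X'
    have hNu : F * (X ∪ X') = F * X ∪ F * X' := Finset.mul_union
    have hNi : F * (X ∩ X') ⊆ F * X ∩ (F * X') := Finset.mul_inter_subset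
    have hNic := Finset.card_le_card hNi
    have hcN := Finset.card_union_add_card_inter (F * X) (F * X')
    have hu := k_pos F hF hgen ⟨s0, hs0⟩ (X ∪ X') ⟨x, Finset.mem_union_left _ hx⟩ (by omega)
    rw [hNu] at hu
    by_cases hlt : (X ∩ X').card < X.card
    · exfalso
      refine ih (X ∩ X').card (by omega) (X ∩ X') rfl ⟨⟨_, hmem⟩, ⟨b, ?_⟩, by omega, by omega⟩
      intro y hy; exact hb y (Finset.mem_inter.1 hy).1
    · have e1 : X ∩ X' = X' := Finset.eq_of_subset_of_card_le Finset.inter_subset_right (by omega)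
      intro z hz
      have : z * g ∈ X ∩ X' := by rw [e1]; exact Finset.mem_image_of_mem _ hz
      exact (Finset.mem_inter.1 this).1
  -- exists y outside s0 X
  have hss : s0 • X ⊆ F * X := Finset.smul_finset_subset_mul hs0
  obtain ⟨y, hy, hy0⟩ := Finset.exists_mem_notMem_of_card_lt_card
    (show (s0 • X).card < (F * X).card by rw [Finset.card_smul_finset]; omega)
  obtain ⟨t, ht, x, hx, rfl⟩ := Finset.mem_mul.1 hy
  have hdis : Disjoint (t • X) (s0 • X) := by
    rw [Finset.disjoint_left]
    intro z hz hz'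
    obtain ⟨u, hu, rfl⟩ := Finset.mem_smul_finset.1 hz
    obtain ⟨w, hw, hwu⟩ := Finset.mem_smul_finset.1 hz'
    apply hy0
    refine Finset.mem_smul_finset.2 ⟨w * (u⁻¹ * x), block _ u hu (by simpa using hx) w hw, ?_⟩
    simp only [smul_eq_mul] at hwu ⊢
    rw [← mul_assoc, hwu]; group
  have hle := Finset.card_le_card (Finset.union_subset (Finset.smul_finset_subset_mul ht) hss)
  rw [Finset.card_union_of_disjoint hdis, Finset.card_smul_finset, Finset.card_smul_finset] at hle
  omega
end key

theorem two_matching {V : Type*} {G : SimpleGraph V} {a b x y : V} (h1 : G.Adj a b)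
    (h2 : G.Adj x y) (hax : a ≠ x) (hay : a ≠ y) (hbx : b ≠ x) (hby : b ≠ y) :
    ∃ M : G.Subgraph, M.IsMatching ∧ M.edgeSet.ncard = 2 ∧ s(a, b) ∈ M.edgeSet ∧
      s(x, y) ∈ M.edgeSet := by
  refine ⟨G.subgraphOfAdj h1 ⊔ G.subgraphOfAdj h2, ?_, ?_, ?_, ?_⟩
  · apply Subgraph.IsMatching.sup (Subgraph.IsMatching.subgraphOfAdj h1)
      (Subgraph.IsMatching.subgraphOfAdj h2)
    rw [(Subgraph.IsMatching.subgraphOfAdj h1).support_eq_verts,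
      (Subgraph.IsMatching.subgraphOfAdj h2).support_eq_verts, Set.disjoint_left]
    intro z hz
    simp at hz ⊢
    rcases hz with rfl | rfl <;> simp [*]
  · rw [Subgraph.edgeSet_sup, edgeSet_subgraphOfAdj, edgeSet_subgraphOfAdj, Set.singleton_union,
      Set.ncard_pair]
    simp [hax, hay]
  · simp
  · simp

theorem cyc_adj {N : ℕ} (hN : 3 ≤ N) (i j : Fin N) :
    (cycleGraph N).Adj i j ↔ (j.val = i.val + 1 ∨ i.val = j.val + 1 ∨
      (i.val = 0 ∧ j.val + 1 = N) ∨ (j.val = 0 ∧ i.val + 1 = N)) := by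
  have key : ∀ i j : Fin N, (i - j).val = 1 ↔ (i.val = j.val + 1 ∨ (i.val = 0 ∧ j.val + 1 = N)) := by
    intro i j
    have hi := i.isLt
    have hj := j.isLt
    rw [Fin.val_sub]
    by_cases h : j.val ≤ i.val
    · have : N - j.val + i.val = (i.val - j.val) + N := by omega
      rw [this, Nat.add_mod_right, Nat.mod_eq_of_lt (by omega)]
      omega
    · rw [Nat.mod_eq_of_lt (by omega)]
      omega
  rw [cycleGraph_adj', key, key]
  omega

theorem cycle_not_ext {V : Type*} [Fintype V] (G : SimpleGraph V) (hV : 6 ≤ Fintype.card V)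
    (n : ℕ) (e : G ≃g cycleGraph n) : ¬ IsNExtendable G 2 := by
  have hn : 6 ≤ n := by
    have := Fintype.card_congr e.toEquiv
    simp at this; omega
  rintro ⟨-, -, h⟩
  have hadj : ∀ i j (hi : i < n) (hj : j < n), j = i + 1 →
      G.Adj (e.symm ⟨i, hi⟩) (e.symm ⟨j, hj⟩) := by
    intro i j hi hj hij
    rw [e.symm.map_adj_iff, cyc_adj (by omega)]
    left; exact hij
  have hne : ∀ i j (hi : i < n) (hj : j < n), i ≠ j → e.symm ⟨i, hi⟩ ≠ e.symm ⟨j, hj⟩ := by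
    intro i j hi hj hij h
    have := e.symm.injective h
    simp at this; exact hij this
  obtain ⟨M, hM, hM2, he1, he2⟩ := two_matching (hadj 0 1 (by omega) (by omega) rfl)
    (hadj 3 4 (by omega) (by omega) rfl) (hne _ _ _ _ (by omega)) (hne _ _ _ _ (by omega))
    (hne _ _ _ _ (by omega)) (hne _ _ _ _ (by omega))
  obtain ⟨P, hP, hMP⟩ := h M hM hM2
  rw [Subgraph.isPerfectMatching_iff] at hP
  have p1 : P.Adj _ _ := hMP he1
  have p2 : P.Adj _ _ := hMP he2
  obtain ⟨w, hw, -⟩ := hP (e.symm ⟨2, by omega⟩)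
  have hw' := P.adj_sub hw
  rw [← e.map_adj_iff, cyc_adj (by omega)] at hw'
  simp only [RelIso.apply_symm_apply] at hw'
  have : (e w).val = 3 ∨ (e w).val = 1 := by omega
  rcases this with h | h
  · have : w = e.symm ⟨3, by omega⟩ := by
      apply e.injective; simp; exact Fin.ext h
    rw [this] at hw
    exact hne 2 4 (by omega) (by omega) (by omega) ((hP _).unique hw.symm p2)
  · have : w = e.symm ⟨1, by omega⟩ := by
      apply e.injective; simp; exact Fin.ext h
    rw [this] at hw
    exact hne 2 0 (by omega) (by omega) (by omega) ((hP _).unique hw.symm p1.symm)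

theorem color_hom {Γ : Type*} [Group Γ] (S : Set Γ)
    (hS : ∀ s ∈ S, s⁻¹ ∈ S) (hid : (1 : Γ) ∉ S) (hgen : Subgroup.closure S = ⊤)
    (hbip : (cayleyGraph Γ S hS).Colorable 2) :
    ∃ c : Γ → Bool, (∀ x y, c (x * y) = xor (c x) (c y)) ∧ ∀ s ∈ S, c s = true := by
  obtain ⟨C⟩ := hbip
  let d : Γ → Bool := fun x => decide (C x = 0)
  have hd : ∀ s ∈ S, ∀ x, d (s * x) = !(d x) := by
    intro s hs x
    have hadj : (cayleyGraph Γ S hS).Adj (s * x) x := by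
      refine ⟨?_, by simpa using hs⟩
      intro h
      have : s = 1 := by simpa using h
      exact hid (this ▸ hs)
    have := C.valid hadj
    simp only [d]
    generalize C (s * x) = u at *
    generalize C x = w at *
    revert this; revert u w; decide
  have hQ : ∀ g : Γ, ∃ b : Bool, ∀ x, d (g * x) = xor b (d x) := by
    intro g
    have hg : g ∈ Subgroup.closure S := by rw [hgen]; trivial
    induction hg using Subgroup.closure_induction'' with
    | mem s h => exact ⟨true, fun x => by simp [hd s h]⟩
    | inv_mem s h => exact ⟨true, fun x => by simp [hd _ (hS s h)]⟩
    | one => exact ⟨false, by simp⟩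
    | mul a b _ _ ha hb =>
      obtain ⟨u, hu⟩ := ha
      obtain ⟨w, hw⟩ := hb
      exact ⟨xor u w, fun x => by rw [mul_assoc, hu, hw, Bool.xor_assoc]⟩
  choose c hc using hQ
  refine ⟨c, ?_, ?_⟩
  · intro x y
    have h1 := hc (x * y) 1
    rw [mul_assoc, hc x, hc y] at h1
    revert h1
    cases c x <;> cases c y <;> cases c (x * y) <;> cases d 1 <;> simp
  · intro s hs
    have h1 := hc s 1
    rw [hd s hs] at h1
    revert h1
    cases c s <;> cases d 1 <;> simp

theorem cay_adj {Γ : Type*} [Group Γ] (S : Set Γ)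
    (hS : ∀ s ∈ S, s⁻¹ ∈ S) (hid : (1 : Γ) ∉ S) (x y : Γ) :
    (cayleyGraph Γ S hS).Adj x y ↔ x * y⁻¹ ∈ S := by
  constructor
  · exact fun h => h.2
  · intro h
    refine ⟨?_, h⟩
    rintro rfl
    exact hid (by simpa using h)

theorem two_gen_cycle {Γ : Type*} [Group Γ] [Fintype Γ] (s0 s1 : Γ)
    (hS : ∀ s ∈ ({s0, s1} : Set Γ), s⁻¹ ∈ ({s0, s1} : Set Γ)) (hid : (1 : Γ) ∉ ({s0, s1} : Set Γ))
    (hgen : Subgroup.closure ({s0, s1} : Set Γ) = ⊤) (hcard : 6 ≤ Fintype.card Γ)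
    (c : Γ → Bool) (hc : ∀ x y, c (x * y) = xor (c x) (c y))
    (hcS : ∀ s ∈ ({s0, s1} : Set Γ), c s = true) :
    ∃ n : ℕ, Nonempty (cayleyGraph Γ {s0, s1} hS ≃g cycleGraph n) := by
  set g := s0⁻¹ * s1 with hg
  have hs1 : s1 = s0 * g := by simp [hg]
  set m := orderOf g with hm
  have hmpos : 0 < m := orderOf_pos g
  have c1 : c 1 = false := by have := hc 1 1; simpa using this
  have cinv : ∀ x, c x⁻¹ = c x := by
    intro x
    have := hc x⁻¹ x
    rw [inv_mul_cancel, c1] at this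
    revert this; cases c x <;> cases c x⁻¹ <;> simp
  have c0 : c s0 = true := hcS _ (by simp)
  have cg : c g = false := by rw [hg, hc, cinv, c0, hcS s1 (by simp)]; rfl
  have cpow : ∀ k : ℕ, c (g ^ k) = false := by
    intro k
    induction k with
    | zero => simpa using c1
    | succ k ih => rw [pow_succ, hc, ih, cg]; rfl
  -- surjectivity
  have hcl : ∀ h x : Γ, (∃ i : ℤ, x = g ^ i ∨ x = s0 * g ^ i) →
      (∃ i : ℤ, h * x = g ^ i ∨ h * x = s0 * g ^ i) := by
    intro h
    have hh : h ∈ Subgroup.closure ({s0, s1} : Set Γ) := by rw [hgen]; trivial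
    have hs : ∀ s, s ∈ ({s0, s1} : Set Γ) → ∀ x : Γ, (∃ i : ℤ, x = g ^ i ∨ x = s0 * g ^ i) →
      (∃ i : ℤ, s * x = g ^ i ∨ s * x = s0 * g ^ i) := by
      rintro s hs x ⟨i, rfl | rfl⟩
      · rcases hs with rfl | rfl
        · exact ⟨i, Or.inr rfl⟩
        · exact ⟨1 + i, Or.inr (by rw [zpow_add, zpow_one, ← mul_assoc, ← hs1])⟩
      · rcases hS s hs with h | h
        · exact ⟨i, Or.inl (by rw [← h]; simp)⟩
        · refine ⟨-1 + i, Or.inl ?_⟩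
          have h' : s⁻¹ = s1 := h
          have : s = s1⁻¹ := by rw [← h', inv_inv]
          rw [zpow_add, zpow_neg_one, hg, this]
          group
    induction hh using Subgroup.closure_induction'' with
    | mem s h => exact hs s h
    | inv_mem s h => exact hs _ (hS s h)
    | one => simp
    | mul a b _ _ ha hb => intro x hx; rw [mul_assoc]; exact ha _ (hb _ hx)
  have hsurj : ∀ x : Γ, ∃ k : ℕ, k < m ∧ (x = g ^ k ∨ x = s0 * g ^ k) := by
    intro x
    obtain ⟨i, hi⟩ := hcl x 1 ⟨0, by simp⟩
    rw [mul_one] at hi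
    have hk : g ^ (i % (m : ℤ)).toNat = g ^ i := by
      rw [← zpow_natCast, Int.toNat_of_nonneg (Int.emod_nonneg _ (by omega)), hm, zpow_mod_orderOf]
    refine ⟨(i % (m : ℤ)).toNat, ?_, ?_⟩
    · have := Int.emod_lt_of_pos i (show (0 : ℤ) < m by omega)
      omega
    · rw [hk]; exact hi
  let f : Fin (2 * m) → Γ := fun k => if k.val % 2 = 0 then s0 * g ^ (k.val / 2) else g ^ (k.val / 2)
  have hpow : ∀ p q : ℕ, p < m → q < m → g ^ p = g ^ q → p = q := by
    intro p q hp hq h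
    exact pow_injOn_Iio_orderOf hp hq h
  have cf : ∀ k, c (f k) = decide (k.val % 2 = 0) := by
    intro k
    by_cases h : k.val % 2 = 0 <;> simp [f, h, hc, c0, cpow]
  have hf : Function.Bijective f := by
    constructor
    · intro i j hij
      have hc' := congrArg c hij
      rw [cf, cf] at hc'
      have hi := i.isLt
      have hj := j.isLt
      by_cases h : i.val % 2 = 0
      · have h' : j.val % 2 = 0 := by simpa [h] using hc'
        simp only [f, h, h', if_true] at hij
        have := hpow _ _ (by omega) (by omega) (mul_left_cancel hij)
        apply Fin.ext; omega
      · have h' : ¬ j.val % 2 = 0 := by simpa [h] using hc'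
        simp only [f, h, h', if_false] at hij
        have := hpow _ _ (by omega) (by omega) hij
        apply Fin.ext; omega
    · intro x
      obtain ⟨k, hk, h | h⟩ := hsurj x
      · refine ⟨⟨2 * k + 1, by omega⟩, ?_⟩
        have e1 : (2 * k + 1) % 2 ≠ 0 := by omega
        have e2 : (2 * k + 1) / 2 = k := by omega
        simp only [f, e1, e2, if_false, h]
      · refine ⟨⟨2 * k, by omega⟩, ?_⟩
        have e1 : (2 * k) % 2 = 0 := by omega
        have e2 : (2 * k) / 2 = k := by omega
        simp only [f, e1, e2, if_true, h]
  have hcardm : 2 * m = Fintype.card Γ := by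
    have := Fintype.card_of_bijective hf
    simpa using this
  -- adjacency between an even and an odd index
  have hadj : ∀ i j : Fin (2 * m), i.val % 2 = 0 → ¬ j.val % 2 = 0 →
      ((cayleyGraph Γ {s0, s1} hS).Adj (f i) (f j) ↔ (cycleGraph (2 * m)).Adj i j) := by
    intro i j h h'
    have hi := i.isLt
    have hj := j.isLt
    rw [cay_adj _ _ hid, cyc_adj (by omega)]
    simp only [f, h, h', if_true, if_false, Set.mem_insert_iff, Set.mem_singleton_iff]
    have e1 : s0 * g ^ (i.val / 2) * (g ^ (j.val / 2))⁻¹ = s0 ↔ i.val / 2 = j.val / 2 := by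
      rw [mul_inv_eq_iff_eq_mul, mul_right_inj]
      exact ⟨fun h => hpow _ _ (by omega) (by omega) h, fun h => by rw [h]⟩
    have e2 : s0 * g ^ (i.val / 2) * (g ^ (j.val / 2))⁻¹ = s1 ↔
        (i.val / 2 = j.val / 2 + 1 ∨ (i.val / 2 = 0 ∧ j.val / 2 + 1 = m)) := by
      rw [mul_inv_eq_iff_eq_mul, hs1, mul_assoc, mul_right_inj, ← pow_succ']
      by_cases hlast : j.val / 2 + 1 = m
      · have hgm : g ^ (j.val / 2 + 1) = 1 := by rw [hlast]; exact pow_orderOf_eq_one g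
        rw [hgm]
        constructor
        · intro h
          have := hpow (i.val / 2) 0 (by omega) hmpos (by simpa using h)
          right; exact ⟨this, hlast⟩
        · rintro (h | h)
          · omega
          · rw [h.1, pow_zero]
      · constructor
        · intro h; left; exact hpow _ _ (by omega) (by omega) h
        · rintro (h | h)
          · rw [h]
          · omega
    rw [e1, e2]
    omega
  refine ⟨2 * m, ⟨SimpleGraph.Iso.symm ⟨Equiv.ofBijective f hf, ?_⟩⟩⟩
  intro i j
  simp only [Equiv.ofBijective_apply]
  by_cases h : i.val % 2 = 0 <;> by_cases h' : j.val % 2 = 0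
  · constructor
    · intro hA
      exfalso
      have := hcS _ ((cay_adj _ _ hid _ _).1 hA)
      rw [hc, cinv, cf, cf] at this
      simp [h, h'] at this
    · rw [cyc_adj (by omega)]; intro hA; omega
  · exact hadj i j h h'
  · rw [SimpleGraph.adj_comm, hadj j i h' h, SimpleGraph.adj_comm]
  · constructor
    · intro hA
      exfalso
      have := hcS _ ((cay_adj _ _ hid _ _).1 hA)
      rw [hc, cinv, cf, cf] at this
      simp [h, h'] at this
    · rw [cyc_adj (by omega)]; intro hA; omega

theorem card_ge_three {Γ : Type*} [Group Γ] [Fintype Γ] (S : Set Γ)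
    (hS : ∀ s ∈ S, s⁻¹ ∈ S) (hid : (1 : Γ) ∉ S) (hgen : Subgroup.closure S = ⊤)
    (hcard : 6 ≤ Fintype.card Γ)
    (c : Γ → Bool) (hc : ∀ x y, c (x * y) = xor (c x) (c y)) (hcS : ∀ s ∈ S, c s = true)
    (hcyc : ¬ ∃ n : ℕ, Nonempty (cayleyGraph Γ S hS ≃g cycleGraph n)) : 3 ≤ S.ncard := by
  by_contra hlt
  have : S.ncard = 0 ∨ S.ncard = 1 ∨ S.ncard = 2 := by omega
  have aux : ∀ s : Γ, S ⊆ {s} → False := by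
    intro s hs
    have : ∃ s, S = {s, s} := by
      rcases Set.subset_singleton_iff_eq.1 hs with h | h
      · exfalso
        rw [h, Subgroup.closure_empty] at hgen
        have h1 : Nat.card (⊤ : Subgroup Γ) = 1 := by rw [← hgen]; simp
        rw [Subgroup.card_top, Nat.card_eq_fintype_card] at h1
        omega
      · exact ⟨s, by simp [h]⟩
    obtain ⟨s, rfl⟩ := this
    exact hcyc (two_gen_cycle s s hS hid hgen hcard c hc hcS)
  rcases this with h | h | h
  · rw [Set.ncard_eq_zero] at h
    exact aux 1 (by simp [h])
  · obtain ⟨s, rfl⟩ := Set.ncard_eq_one.1 h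
    exact aux s subset_rfl
  · obtain ⟨s, t, -, rfl⟩ := Set.ncard_eq_two.1 h
    exact hcyc (two_gen_cycle s t hS hid hgen hcard c hc hcS)

theorem extend_pair {Γ : Type*} [Group Γ] [Fintype Γ] (S : Set Γ)
    (hS : ∀ s ∈ S, s⁻¹ ∈ S) (hid : (1 : Γ) ∉ S) (hgen : Subgroup.closure S = ⊤)
    (c : Γ → Bool) (hc : ∀ x y, c (x * y) = xor (c x) (c y)) (hcS : ∀ s ∈ S, c s = true)
    (h3 : 3 ≤ S.ncard) (a1 b1 a2 b2 : Γ)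
    (h1 : (cayleyGraph Γ S hS).Adj a1 b1) (h2 : (cayleyGraph Γ S hS).Adj a2 b2)
    (ha1 : c a1 = false) (ha2 : c a2 = false) (hcb1 : c b1 = true) (hcb2 : c b2 = true)
    (ha : a1 ≠ a2) (hb : b1 ≠ b2) :
    ∃ P : (cayleyGraph Γ S hS).Subgraph, P.IsPerfectMatching ∧ P.Adj a1 b1 ∧ P.Adj a2 b2 := by
  classical
  set F : Finset Γ := S.toFinset with hFdef
  have memF : ∀ s, s ∈ F ↔ s ∈ S := fun s => by simp [hFdef]
  have hFc : (F : Set Γ) = S := by simp [hFdef]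
  have hF3 : 3 ≤ F.card := by rwa [← Set.ncard_coe_finset, hFc]
  have hfrag := no_frag F (fun s hs => (memF _).2 (hS s ((memF s).1 hs))) (by rw [hFc]; exact hgen)
    hF3 c hc (fun s hs => hcS s ((memF s).1 hs))
  obtain ⟨s0, hs0⟩ : F.Nonempty := Finset.card_pos.1 (by omega)
  have hcl := class_card c hc s0 (hcS _ ((memF _).1 hs0))
  let ι := {a : Γ // c a = false ∧ a ≠ a1 ∧ a ≠ a2}
  let t : ι → Finset Γ := fun a => (F * {a.1}) \ {b1, b2}
  have hall : ∀ X : Finset ι, X.card ≤ (X.biUnion t).card := by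
    intro X
    rcases X.eq_empty_or_nonempty with rfl | hX
    · simp
    set Y : Finset Γ := X.image Subtype.val with hY
    have hYc : Y.card = X.card := Finset.card_image_of_injective _ Subtype.val_injective
    have hsub : (F * Y) \ {b1, b2} ⊆ X.biUnion t := by
      intro z hz
      rw [Finset.mem_sdiff] at hz
      obtain ⟨s, hs, y, hy, rfl⟩ := Finset.mem_mul.1 hz.1
      obtain ⟨x, hx, rfl⟩ := Finset.mem_image.1 hy
      refine Finset.mem_biUnion.2 ⟨x, hx, Finset.mem_sdiff.2 ⟨?_, hz.2⟩⟩
      exact Finset.mul_mem_mul hs (Finset.mem_singleton_self _)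
    have hsub2 := Finset.card_le_card hsub
    have hsd := Finset.le_card_sdiff ({b1, b2} : Finset Γ) (F * Y)
    have hp : ({b1, b2} : Finset Γ).card = 2 := Finset.card_pair hb
    have hYprop : ∀ y ∈ Y, c y = false ∧ y ≠ a1 ∧ y ≠ a2 := by
      intro y hy
      obtain ⟨x, hx, rfl⟩ := Finset.mem_image.1 hy
      exact x.2
    have hdis : Disjoint Y ({a1, a2} : Finset Γ) := by
      rw [Finset.disjoint_left]
      intro y hy
      simp [(hYprop y hy).2]
    have hYs : Y ∪ {a1, a2} ⊆ Finset.univ.filter (fun x => c x = false) := by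
      intro y hy
      simp only [Finset.mem_union, Finset.mem_insert, Finset.mem_singleton] at hy
      simp only [Finset.mem_filter, Finset.mem_univ, true_and]
      rcases hy with hy | rfl | rfl
      · exact (hYprop y hy).1
      · exact ha1
      · exact ha2
    have hYle := Finset.card_le_card hYs
    rw [Finset.card_union_of_disjoint hdis, Finset.card_pair ha] at hYle
    have := hcl false
    by_contra hlt
    exact hfrag Y ⟨hX.image _, ⟨false, fun y hy => (hYprop y hy).1⟩, by omega, by omega⟩
  obtain ⟨g, ginj, hg⟩ := (Finset.all_card_le_biUnion_card_iff_exists_injective t).1 hall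
  let f : Γ → Γ := fun x => if x = a1 then b1 else if x = a2 then b2 else
    if h : c x = false ∧ x ≠ a1 ∧ x ≠ a2 then g ⟨x, h⟩ else x
  have f1 : f a1 = b1 := by simp [f]
  have f2 : f a2 = b2 := by simp [f, ha.symm]
  have f3 : ∀ x (h : c x = false ∧ x ≠ a1 ∧ x ≠ a2), f x = g ⟨x, h⟩ := by
    intro x h
    simp only [f, h.2.1, h.2.2, if_false]
    rw [dif_pos]
  have hg1 : ∀ x, g x ≠ b1 ∧ g x ≠ b2 := by
    intro x
    have := hg x
    simp only [t, Finset.mem_sdiff, Finset.mem_insert, Finset.mem_singleton, not_or] at this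
    exact this.2
  have hadj : ∀ x, c x = false → (cayleyGraph Γ S hS).Adj x (f x) := by
    intro x hx
    by_cases e1 : x = a1
    · rw [e1, f1]; exact h1
    by_cases e2 : x = a2
    · rw [e2, f2]; exact h2
    rw [f3 x ⟨hx, e1, e2⟩]
    have := hg ⟨x, hx, e1, e2⟩
    simp only [t, Finset.mem_sdiff] at this
    obtain ⟨s, hs, y, hy, hsy⟩ := Finset.mem_mul.1 this.1
    rw [Finset.mem_singleton] at hy
    apply SimpleGraph.Adj.symm
    rw [cay_adj S hS hid, ← hsy, hy]
    simpa using (memF s).1 hs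
  have hinj : ∀ x y, c x = false → c y = false → f x = f y → x = y := by
    intro x y hx hy hxy
    by_cases e1 : x = a1 <;> by_cases e2 : x = a2 <;> by_cases e3 : y = a1 <;> by_cases e4 : y = a2
    all_goals first
      | (rw [f3 x ⟨hx, e1, e2⟩, f3 y ⟨hy, e3, e4⟩] at hxy
         exact congrArg Subtype.val (ginj hxy))
      | (rw [f3 x ⟨hx, e1, e2⟩] at hxy
         have := hg1 ⟨x, hx, e1, e2⟩
         grind)
      | (rw [f3 y ⟨hy, e3, e4⟩] at hxy
         have := hg1 ⟨y, hy, e3, e4⟩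
         grind)
      | grind
  have cadj : ∀ x y, (cayleyGraph Γ S hS).Adj x y → c x = !(c y) := by
    intro x y h
    have h4 := hcS _ ((cay_adj S hS hid x y).1 h)
    have h5 := hc (x * y⁻¹) y
    rw [h4] at h5
    simpa using h5
  have hcf : ∀ x, c x = false → c (f x) = true := by
    intro x hx
    have := cadj _ _ (hadj x hx)
    rw [hx] at this
    simpa using this.symm
  have hsurj : ∀ y, c y = true → ∃ x, c x = false ∧ f x = y := by
    have himg : (Finset.univ.filter (fun x => c x = false)).image f =
        Finset.univ.filter (fun x => c x = true) := by
      apply Finset.eq_of_subset_of_card_le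
      · intro y hy
        obtain ⟨x, hx, rfl⟩ := Finset.mem_image.1 hy
        simp at hx ⊢
        exact hcf x hx
      · rw [Finset.card_image_of_injOn]
        · have := hcl true
          have := hcl false
          omega
        · intro x hx y hy hxy
          exact hinj x y (by simpa using hx) (by simpa using hy) hxy
    intro y hy
    have : y ∈ (Finset.univ.filter (fun x => c x = false)).image f := by rw [himg]; simp [hy]
    obtain ⟨x, hx, hxy⟩ := Finset.mem_image.1 this
    exact ⟨x, by simpa using hx, hxy⟩
  refine ⟨{ verts := Set.univ
            Adj := fun x y => (c x = false ∧ f x = y) ∨ (c y = false ∧ f y = x)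
            adj_sub := ?_
            edge_vert := fun _ => Set.mem_univ _
            symm := ?_ }, ?_, ?_, ?_⟩
  · rintro x y (⟨h, rfl⟩ | ⟨h, rfl⟩)
    · exact hadj x h
    · exact (hadj y h).symm
  · constructor
    intro x y h
    exact h.symm
  · rw [Subgraph.isPerfectMatching_iff]
    intro v
    cases hv : c v with
    | false =>
      refine ⟨f v, Or.inl ⟨hv, rfl⟩, ?_⟩
      rintro y (⟨-, h⟩ | ⟨h, h'⟩)
      · exact h.symm
      · have := hcf y h
        rw [h', hv] at this
        cases this
    | true =>
      obtain ⟨x, hx, hxv⟩ := hsurj v hv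
      refine ⟨x, Or.inr ⟨hx, hxv⟩, ?_⟩
      rintro y (⟨h, -⟩ | ⟨h, h'⟩)
      · rw [hv] at h; cases h
      · exact hinj y x h hx (h'.trans hxv.symm)
  · exact Or.inl ⟨ha1, f1⟩
  · exact Or.inl ⟨ha2, f2⟩

theorem ext_of_not_cycle {Γ : Type*} [Group Γ] [Fintype Γ] (S : Set Γ)
    (hS : ∀ s ∈ S, s⁻¹ ∈ S) (hid : (1 : Γ) ∉ S) (hgen : Subgroup.closure S = ⊤)
    (hcard : 6 ≤ Fintype.card Γ)
    (c : Γ → Bool) (hc : ∀ x y, c (x * y) = xor (c x) (c y)) (hcS : ∀ s ∈ S, c s = true)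
    (h3 : 3 ≤ S.ncard) : IsNExtendable (cayleyGraph Γ S hS) 2 := by
  classical
  refine ⟨by omega, ?_, ?_⟩
  · obtain ⟨s, hs⟩ : S.Nonempty := Set.nonempty_of_ncard_ne_zero (by omega)
    have hs1 : s ≠ 1 := fun h => hid (h ▸ hs)
    obtain ⟨y, -, hy⟩ := Finset.exists_mem_notMem_of_card_lt_card
      (show ({1, s, s⁻¹} : Finset Γ).card < (Finset.univ : Finset Γ).card by
        rw [Finset.card_univ]; exact lt_of_le_of_lt Finset.card_le_three (by omega))
    simp only [Finset.mem_insert, Finset.mem_singleton, not_or] at hy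
    obtain ⟨M, hM, hM2, -, -⟩ := two_matching (G := cayleyGraph Γ S hS) (a := s) (b := 1)
      (x := s * y) (y := y)
      (by rw [cay_adj S hS hid]; simpa using hs) (by rw [cay_adj S hS hid]; simpa using hs)
      (by intro h; exact hy.1 (by simpa using h)) (fun h => hy.2.1 h.symm)
      (by intro h; exact hy.2.2 (eq_inv_of_mul_eq_one_right h.symm)) (fun h => hy.1 h.symm)
    exact ⟨M, hM, hM2⟩
  · intro M hM hM2
    obtain ⟨e1, e2, hne, hE⟩ := Set.ncard_eq_two.1 hM2
    have cadj : ∀ x y, (cayleyGraph Γ S hS).Adj x y → c x = !(c y) := by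
      intro x y h
      have h4 := hcS _ ((cay_adj S hS hid x y).1 h)
      have h5 := hc (x * y⁻¹) y
      rw [h4] at h5
      simpa using h5
    have orient : ∀ e ∈ M.edgeSet, ∃ a b, e = s(a, b) ∧ M.Adj a b ∧ c a = false ∧ c b = true := by
      intro e
      induction e using Sym2.ind with
      | _ x y =>
      intro h
      have h' : M.Adj x y := h
      have hcc := cadj _ _ (M.adj_sub h')
      cases hy : c y with
      | true => exact ⟨x, y, rfl, h', by simp [hcc, hy], hy⟩
      | false => exact ⟨y, x, Sym2.eq_swap, h'.symm, hy, by simp [hcc, hy]⟩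
    obtain ⟨a1, b1, he1, hM1, ha1, hb1⟩ := orient e1 (by rw [hE]; simp)
    obtain ⟨a2, b2, he2, hM2', ha2, hb2⟩ := orient e2 (by rw [hE]; simp)
    have hab : a1 ≠ a2 := by
      rintro rfl
      apply hne
      rw [he1, he2, (hM (M.edge_vert hM1)).unique hM1 hM2']
    have hbb : b1 ≠ b2 := by
      rintro rfl
      apply hne
      rw [he1, he2, (hM (M.edge_vert hM1.symm)).unique hM1.symm hM2'.symm]
    obtain ⟨P, hP, hp1, hp2⟩ := extend_pair S hS hid hgen c hc hcS h3 a1 b1 a2 b2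
      (M.adj_sub hM1) (M.adj_sub hM2') ha1 ha2 hb1 hb2 hab hbb
    refine ⟨P, hP, ?_⟩
    rw [hE, he1, he2]
    rintro e (rfl | rfl)
    · exact hp1
    · exact hp2

/-- A connected bipartite Cayley graph on a finite group with at least 6 elements is
2-extendable iff it is not isomorphic to a cycle graph. -/
theorem bipartite_cayley_two_extendable_iff (Γ : Type*) [Group Γ] [Fintype Γ] (S : Set Γ)
    (hS : ∀ s ∈ S, s⁻¹ ∈ S) (hid : (1 : Γ) ∉ S) (hgen : Subgroup.closure S = ⊤)
    (hconn : (cayleyGraph Γ S hS).Connected)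
    (hbip : (cayleyGraph Γ S hS).Colorable 2) (hcard : 6 ≤ Fintype.card Γ) :
    IsNExtendable (cayleyGraph Γ S hS) 2 ↔
      ¬ ∃ n : ℕ, Nonempty (cayleyGraph Γ S hS ≃g SimpleGraph.cycleGraph n) := by
  constructor
  · rintro h ⟨n, ⟨e⟩⟩
    exact cycle_not_ext _ hcard n e h
  · intro h
    obtain ⟨c, hc, hcS⟩ := color_hom S hS hid hgen hbip
    exact ext_of_not_cycle S hS hid hgen hcard c hc hcS
      (card_ge_three S hS hid hgen hcard c hc hcS h)
end
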